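/- arXiv:cs/0702082 — 6 statements merged into one kernel-verified Lean document; each statement's English description precedes it below -/
import Mathlib

section
/- Theorem 2, part 1 (boundedness of the coupled Hindmarsh-Rose network). For every coupling strength gamma > 0 and every family of bounded continuous inputs phi_0, ..., phi_n, every solution of the coupled Hindmarsh-Rose network defined on [0, infinity) is bounded: all functions x_i, y_i, z_i, i = 0, ..., n, are bounded on [0, infinity). -/
lemma hr_gron (V V' : ℝ → ℝ) (k M : ℝ) (hk : 0 < k)
    (hV : ∀ t, 0 ≤ t → HasDerivAt V (V' t) t)
    (h : ∀ t, 0 ≤ t → V' t ≤ k * (M - V t)) (t : ℝ) (ht : 0 ≤ t) :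
    V t ≤ M + |V 0 - M| := by
  have hg : ∀ t, 0 ≤ t → HasDerivAt (fun t => Real.exp (k * t) * (V t - M))
      ((Real.exp (k * t) * (k * 1)) * (V t - M) + Real.exp (k * t) * (V' t)) t := by
    intro t ht
    exact (((hasDerivAt_id t).const_mul k).exp).mul ((hV t ht).sub_const M)
  have hanti : AntitoneOn (fun t => Real.exp (k * t) * (V t - M)) (Set.Ici 0) := by
    apply antitoneOn_of_deriv_nonpos (convex_Ici 0)
    · intro t ht
      exact (hg t ht).continuousAt.continuousWithinAt
    · intro t ht
      rw [interior_Ici] at ht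
      exact (hg t (le_of_lt ht)).differentiableAt.differentiableWithinAt
    · intro t ht
      rw [interior_Ici] at ht
      have ht0 : (0:ℝ) ≤ t := le_of_lt ht
      rw [(hg t ht0).deriv]
      have h1 := h t ht0
      have h2 := mul_le_mul_of_nonneg_left h1 (Real.exp_pos (k * t)).le
      linarith
  have h1 := hanti (Set.mem_Ici.2 le_rfl) (Set.mem_Ici.2 ht) ht
  simp only [mul_zero, Real.exp_zero, one_mul] at h1
  by_contra hcon
  push Not at hcon
  have h3 := abs_nonneg (V 0 - M)
  have h4 := le_abs_self (V 0 - M)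
  have h5 : 1 ≤ Real.exp (k * t) := Real.one_le_exp (by positivity)
  nlinarith

lemma hr_node (a b c d eps s x₀ P : ℝ) (ha : 0 < a) (hd : 0 < d) (heps : 0 < eps)
    (hs : 0 < s) : ∃ k K : ℝ, 0 < k ∧ ∀ x y z p : ℝ, |p| ≤ P →
    -a * x ^ 4 + b * x ^ 3 + x * y + p * x + (a / d ^ 2) * (c * y - d * x ^ 2 * y - y ^ 2)
      + x₀ * z - z ^ 2 / s ≤
    K - k * (x ^ 2 + (a / d ^ 2) * y ^ 2 + z ^ 2 / (eps * s)) := by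
  set k := min (1 / 4) (eps / 2) with hkdef
  have hk : 0 < k := by positivity
  have hk1 : k ≤ 1 / 4 := min_le_left _ _
  have hk2 : k ≤ eps / 2 := min_le_right _ _
  set m := b ^ 2 / a + 2 * d ^ 2 / a + 1 / 4 + 1 / 4 with hm
  refine ⟨k, m ^ 2 / a + 2 * a * (c / d) ^ 2 + P ^ 2 + s * x₀ ^ 2 / 2, hk, ?_⟩
  intro x y z p hp
  obtain ⟨w, rfl⟩ : ∃ w, y = d * w := ⟨y / d, by field_simp⟩
  have e1 : (a / d ^ 2) * (c * (d * w) - d * x ^ 2 * (d * w) - (d * w) ^ 2)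
      = a * (c / d) * w - a * (x ^ 2 * w) - a * w ^ 2 := by field_simp
  have e2 : (a / d ^ 2) * (d * w) ^ 2 = a * w ^ 2 := by field_simp
  rw [e1, e2]
  have i1 : -(a * (x ^ 2 * w)) ≤ a * x ^ 4 / 2 + a * w ^ 2 / 2 := by
    nlinarith [mul_nonneg ha.le (sq_nonneg (x ^ 2 + w))]
  have i2 : x * (d * w) ≤ a * w ^ 2 / 8 + 2 * d ^ 2 / a * x ^ 2 := by
    have : a * w ^ 2 / 8 + 2 * d ^ 2 / a * x ^ 2 - x * (d * w)
      = (a * w - 4 * d * x) ^ 2 / (8 * a) := by field_simp; ring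
    have : 0 ≤ (a * w - 4 * d * x) ^ 2 / (8 * a) := by positivity
    linarith
  have i3 : a * (c / d) * w ≤ a * w ^ 2 / 8 + 2 * a * (c / d) ^ 2 := by
    nlinarith [mul_nonneg ha.le (sq_nonneg (w - 4 * (c / d)))]
  have i4 : b * x ^ 3 ≤ a * x ^ 4 / 4 + b ^ 2 / a * x ^ 2 := by
    have : a * x ^ 4 / 4 + b ^ 2 / a * x ^ 2 - b * x ^ 3
      = (a * x ^ 2 - 2 * b * x) ^ 2 / (4 * a) := by field_simp; ring
    have : 0 ≤ (a * x ^ 2 - 2 * b * x) ^ 2 / (4 * a) := by positivity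
    linarith
  have i5 : p * x ≤ P ^ 2 + x ^ 2 / 4 := by
    have : p ^ 2 ≤ P ^ 2 := sq_le_sq' (by linarith [neg_abs_le p]) (by linarith [le_abs_self p])
    nlinarith [sq_nonneg (p - x / 2)]
  have i6 : m * x ^ 2 ≤ a * x ^ 4 / 4 + m ^ 2 / a := by
    have : a * x ^ 4 / 4 + m ^ 2 / a - m * x ^ 2
      = (a * x ^ 2 - 2 * m) ^ 2 / (4 * a) := by field_simp; ring
    have : 0 ≤ (a * x ^ 2 - 2 * m) ^ 2 / (4 * a) := by positivity
    linarith
  have i7 : x₀ * z ≤ z ^ 2 / s / 2 + s * x₀ ^ 2 / 2 := by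
    have : z ^ 2 / s / 2 + s * x₀ ^ 2 / 2 - x₀ * z = (z - s * x₀) ^ 2 / (2 * s) := by
      field_simp; ring
    have : 0 ≤ (z - s * x₀) ^ 2 / (2 * s) := by positivity
    linarith
  have i8 : k * (z ^ 2 / (eps * s)) ≤ z ^ 2 / s / 2 := by
    calc k * (z ^ 2 / (eps * s)) ≤ eps / 2 * (z ^ 2 / (eps * s)) := by gcongr
      _ = _ := by field_simp
  have i9 : k * x ^ 2 ≤ 1 / 4 * x ^ 2 := by gcongr
  have i10 : k * (a * w ^ 2) ≤ 1 / 4 * (a * w ^ 2) := by gcongr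
  have i11 : m * x ^ 2 = b ^ 2 / a * x ^ 2 + 2 * d ^ 2 / a * x ^ 2 + x ^ 2 / 4 + x ^ 2 / 4 := by
    rw [hm]; ring
  linarith


/-!
Theorem 2, part 1: boundedness of the coupled Hindmarsh-Rose network.

A network of `n+1` Hindmarsh-Rose oscillators with symmetric linear coupling
`u_i(t) = γ (-n x_i(t) + ∑_{j ≠ i} x_j(t))` and bounded continuous inputs
`φ_i`. Every solution on `[0, ∞)` is bounded.
-/
theorem hr_network_bounded
    (n : ℕ) (a b c d eps s x₀bar γ : ℝ) (I : ℝ)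
    (ha : 0 < a) (hb : 0 < b) (hc : 0 < c) (hd : 0 < d) (heps : 0 < eps)
    (hs : 0 < s) (hx₀ : 0 < x₀bar) (hγ : 0 < γ)
    (φ : Fin (n + 1) → ℝ → ℝ)
    (hφcont : ∀ i, Continuous (φ i))
    (hφbdd : ∀ i, ∃ C : ℝ, ∀ t, 0 ≤ t → |φ i t| ≤ C)
    (x y z : Fin (n + 1) → ℝ → ℝ)
    (hx : ∀ i, ∀ t, 0 ≤ t → HasDerivAt (x i)
        (-a * (x i t) ^ 3 + b * (x i t) ^ 2 + y i t - z i t + I +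
          γ * (-(n : ℝ) * x i t + ∑ j ∈ Finset.univ.erase i, x j t) + φ i t) t)
    (hy : ∀ i, ∀ t, 0 ≤ t → HasDerivAt (y i) (c - d * (x i t) ^ 2 - y i t) t)
    (hz : ∀ i, ∀ t, 0 ≤ t →
        HasDerivAt (z i) (eps * (s * (x i t + x₀bar) - z i t)) t) :
    ∃ B : ℝ, ∀ i, ∀ t, 0 ≤ t → |x i t| ≤ B ∧ |y i t| ≤ B ∧ |z i t| ≤ B := by
  choose C hC using hφbdd
  set P := |I| + ∑ i, |C i| with hP
  have hp : ∀ i t, 0 ≤ t → |I + φ i t| ≤ P := by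
    intro i t ht
    have h1 := abs_add_le I (φ i t)
    have h2 := hC i t ht
    have h3 := le_abs_self (C i)
    have h4 := Finset.single_le_sum (f := fun i => |C i|) (fun i _ => abs_nonneg _)
      (Finset.mem_univ i)
    linarith
  obtain ⟨k, K, hk, hnode⟩ := hr_node a b c d eps s x₀bar P ha hd heps hs
  set W : Fin (n + 1) → ℝ → ℝ := fun i t =>
    x i t ^ 2 + (a / d ^ 2) * y i t ^ 2 + z i t ^ 2 / (eps * s) with hW
  set u : Fin (n + 1) → ℝ → ℝ := fun i t =>
    -(n : ℝ) * x i t + ∑ j ∈ Finset.univ.erase i, x j t with hu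
  have hcoup : ∀ t, ∑ i, x i t * u i t ≤ 0 := by
    intro t
    have e : ∀ i, x i t * u i t = x i t * (∑ j, x j t) - (n + 1) * x i t ^ 2 := by
      intro i
      have := Finset.add_sum_erase Finset.univ (fun j => x j t) (Finset.mem_univ i)
      simp only [hu]
      rw [← this]; ring
    simp only [e]
    rw [Finset.sum_sub_distrib, ← Finset.sum_mul, ← Finset.mul_sum]
    have := sq_sum_le_card_mul_sum_sq (s := Finset.univ) (f := fun i => x i t)
    simp at this
    nlinarith
  set W' : Fin (n + 1) → ℝ → ℝ := fun i t =>
    2 * x i t * (-a * (x i t) ^ 3 + b * (x i t) ^ 2 + y i t - z i t + I + γ * u i t + φ i t)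
    + (a / d ^ 2) * (2 * y i t * (c - d * (x i t) ^ 2 - y i t))
    + (2 * z i t * (eps * (s * (x i t + x₀bar) - z i t))) / (eps * s) with hW'
  have hWd : ∀ i t, 0 ≤ t → HasDerivAt (W i) (W' i t) t := by
    intro i t ht
    have h := (((hx i t ht).pow 2).add (((hy i t ht).pow 2).const_mul (a / d ^ 2))).add
      (((hz i t ht).pow 2).div_const (eps * s))
    refine HasDerivAt.congr_deriv (f := W i) h ?_
    simp [hW', hu]
  have hWle : ∀ i t, 0 ≤ t → W' i t ≤ 2 * K - 2 * k * W i t + 2 * γ * (x i t * u i t) := by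
    intro i t ht
    have h := hnode (x i t) (y i t) (z i t) _ (hp i t ht)
    have e : W' i t = 2 * (-a * x i t ^ 4 + b * x i t ^ 3 + x i t * y i t + (I + φ i t) * x i t
      + (a / d ^ 2) * (c * y i t - d * x i t ^ 2 * y i t - y i t ^ 2)
      + x₀bar * z i t - z i t ^ 2 / s) + 2 * γ * (x i t * u i t) := by
      simp only [hW']
      have : (2 * z i t * (eps * (s * (x i t + x₀bar) - z i t))) / (eps * s)
        = 2 * (x i t * z i t + x₀bar * z i t - z i t ^ 2 / s) := by field_simp
      rw [this]; ring
    rw [e]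
    simp only [hW]
    linarith
  clear_value W' W u
  have hV := hr_gron (fun t => ∑ i, W i t) (fun t => ∑ i, W' i t) (2 * k)
    ((n + 1) * K / k) (by positivity)
    (fun t ht => HasDerivAt.fun_sum (fun i _ => hWd i t ht)) (by
      intro t ht
      have h := Finset.sum_le_sum (s := Finset.univ) (fun i _ => hWle i t ht)
      rw [Finset.sum_add_distrib, Finset.sum_sub_distrib, ← Finset.mul_sum, ← Finset.mul_sum,
        ← Finset.mul_sum] at h
      simp at h
      have h2 := mul_nonneg hγ.le (neg_nonneg.2 (hcoup t))
      have e : 2 * k * ((n + 1) * K / k - ∑ i, W i t) =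
        (n + 1) * (2 * K) - 2 * k * ∑ i, W i t := by field_simp
      rw [e]
      linarith)
  set M := (n + 1) * K / k + |∑ i, W i 0 - (n + 1) * K / k| with hM
  have hWM : ∀ i t, 0 ≤ t → W i t ≤ M := by
    intro i t ht
    refine le_trans ?_ (hV t ht)
    exact Finset.single_le_sum (f := fun i => W i t) (fun i _ => by simp only [hW]; positivity)
      (Finset.mem_univ i)
  have hA : 0 < a / d ^ 2 := by positivity
  have hE : 0 < eps * s := by positivity
  have hsq : ∀ r Q : ℝ, r ^ 2 ≤ Q → |r| ≤ 1 + Q := by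
    intro r Q h
    have := sq_abs r
    nlinarith [sq_nonneg (|r| - 1), abs_nonneg r]
  have hM0 : 0 ≤ M := le_trans (by simp only [hW]; positivity) (hWM 0 0 le_rfl)
  refine ⟨1 + M + M / (a / d ^ 2) + M * (eps * s), fun i t ht => ?_⟩
  have h := hWM i t ht
  simp only [hW] at h
  have q1 : 0 ≤ x i t ^ 2 := by positivity
  have q2 : 0 ≤ (a / d ^ 2) * y i t ^ 2 := by positivity
  have q3 : 0 ≤ z i t ^ 2 / (eps * s) := by positivity
  have r1 := hsq (x i t) M (by linarith)
  have r2 := hsq (y i t) (M / (a / d ^ 2)) (by rw [le_div_iff₀ hA]; linarith)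
  have r3 := hsq (z i t) (M * (eps * s)) (by rw [← div_le_iff₀ hE]; linarith)
  have p2 : 0 ≤ M / (a / d ^ 2) := by positivity
  have p3 : 0 ≤ M * (eps * s) := by positivity
  exact ⟨by linarith, by linarith, by linarith⟩
end

section
/- Theorem 2, part 2 (synchronization of the coupled Hindmarsh-Rose network). Suppose in addition that gamma > (1/((n+1)*a))*(d^2/2 + b^2). Then for every solution of the coupled Hindmarsh-Rose network there exists a monotone function delta : [0, infinity) -> [0, infinity) with delta(eps') -> 0 as eps' -> 0+ such that for all indices i, j in {0, ..., n} and every eps' >= 0: if limsup_{t->infinity} |phi_i(t) - phi_j(t)| <= eps', then limsup_{t->infinity} |x_i(t) - x_j(t)| <= delta(eps'), limsup_{t->infinity} |y_i(t) - y_j(t)| <= delta(eps'), and limsup_{t->infinity} |z_i(t) - z_j(t)| <= delta(eps'). -/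
lemma hr_quad (D B σ X W : ℝ) (hD : 0 < D) (hB : 0 < B) :
    0 ≤ 7/8*W^2 - (D-σ)*X*W + (3*σ^2/4 - B*σ + D^2/2 + B^2)*X^2 := by
  have h1 : 0 ≤ 3*σ^2/4 - B*σ + D^2/2 + B^2 - 2/7*(D-σ)^2 := by
    have := mul_pos hD hB
    nlinarith [sq_nonneg (σ + 28/26*(4*D/7 - B)), sq_nonneg D, sq_nonneg B]
  have h2 := mul_nonneg h1 (sq_nonneg X)
  nlinarith [sq_nonneg (W - 4/7*(D-σ)*X)]

lemma hr_alg (a D B κ κ₂ μ eps s P Q W Z f : ℝ) (ha : 0 < a) (hD : 0 < D) (hB : 0 < B)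
    (heps : 0 < eps) (hs : 0 < s) (hκ₂ : 0 < κ₂) (hκ : κ = κ₂ + a*(D^2/2 + B^2))
    (m1 : μ ≤ κ₂) (m2 : μ ≤ 1/4) (m3 : μ ≤ 2*eps) :
    (P-Q)*(-a*(P^3-Q^3) + a*B*(P^2-Q^2) + a*D*W - Z - κ*(P-Q) + f)
      + a*(W*(-(P^2-Q^2) - W)) + 1/(eps*s)*(Z*(eps*(s*(P-Q) - Z)))
    ≤ -μ*((P-Q)^2/2 + a*W^2/2 + 1/(eps*s)*(Z^2/2)) + f^2/(2*κ₂) := by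
  have q := mul_nonneg ha.le (hr_quad D B (P+Q) (P-Q) W hD hB)
  have e1 : 1/(eps*s)*(Z*(eps*(s*(P-Q) - Z))) = Z*(P-Q) - 2*eps*(1/(eps*s)*(Z^2/2)) := by
    field_simp
  have e2 : (P-Q)*f ≤ κ₂*(P-Q)^2/2 + f^2/(2*κ₂) := by
    have : κ₂*(P-Q)^2/2 + f^2/(2*κ₂) - (P-Q)*f = (κ₂*(P-Q) - f)^2/(2*κ₂) := by
      field_simp; ring
    have h : 0 ≤ (κ₂*(P-Q) - f)^2/(2*κ₂) := by positivity
    linarith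
  have z0 : 0 ≤ 1/(eps*s)*(Z^2/2) := by positivity
  have b3 := mul_le_mul_of_nonneg_right m3 z0
  have b1 := mul_le_mul_of_nonneg_right m1 (sq_nonneg (P-Q))
  have b2 := mul_le_mul_of_nonneg_right m2 (mul_nonneg ha.le (sq_nonneg W))
  have p4 := mul_nonneg ha.le (sq_nonneg ((P-Q)^2))
  rw [e1]
  generalize 1/(eps*s)*(Z^2/2) = ζ at *
  generalize f^2/(2*κ₂) = g at *
  subst hκ
  nlinarith

lemma hr_gronwall (V V' : ℝ → ℝ) (μ m T η : ℝ) (hμ : 0 < μ) (hη : 0 < η)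
    (hV : ∀ t, T ≤ t → HasDerivAt V (V' t) t)
    (hle : ∀ t, T ≤ t → V' t ≤ -μ * V t + m) :
    ∀ᶠ t in Filter.atTop, V t ≤ m/μ + η := by
  have hd : ∀ t, T ≤ t → HasDerivAt (fun t => Real.exp (μ*t) * (V t - m/μ))
      (Real.exp (μ*t) * (μ*1) * (V t - m/μ) + Real.exp (μ*t) * V' t) t := by
    intro t ht
    exact ((((hasDerivAt_id t).const_mul μ).exp).mul ((hV t ht).sub_const (m/μ)))
  have hanti : AntitoneOn (fun t => Real.exp (μ*t) * (V t - m/μ)) (Set.Ici T) := by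
    apply antitoneOn_of_deriv_nonpos (convex_Ici T)
    · exact fun t ht => (hd t ht).continuousAt.continuousWithinAt
    · intro t ht
      rw [interior_Ici] at ht
      exact (hd t (le_of_lt ht)).differentiableAt.differentiableWithinAt
    · intro t ht
      rw [interior_Ici] at ht
      rw [(hd t (le_of_lt ht)).deriv]
      have h := hle t (le_of_lt ht)
      have h2 : μ*(V t - m/μ) + V' t ≤ 0 := by
        have : μ*(V t - m/μ) = μ * V t - m := by field_simp
        linarith
      have := mul_nonneg_of_nonpos_of_nonpos h2 (neg_nonpos.2 (Real.exp_pos (μ*t)).le)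
      nlinarith
  have hlim : Filter.Tendsto (fun t => Real.exp (μ*t)) Filter.atTop Filter.atTop :=
    Real.tendsto_exp_atTop.comp (Filter.tendsto_id.const_mul_atTop hμ)
  filter_upwards [Filter.eventually_ge_atTop T,
    hlim.eventually_ge_atTop (Real.exp (μ*T) * (V T - m/μ) / η)] with t ht h
  have h1 := hanti (Set.mem_Ici.2 le_rfl) (Set.mem_Ici.2 ht) ht
  simp only at h1
  rw [div_le_iff₀ hη] at h
  have := le_of_mul_le_mul_left (h1.trans h) (Real.exp_pos _)
  linarith

lemma hr_limsup (f : ℝ → ℝ) (K e : ℝ) (hK : 0 < K)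
    (h : ∀ e₁, e < e₁ → ∀ᶠ t in Filter.atTop, |f t| ≤ K*e₁) :
    Filter.limsup (fun t => |f t|) Filter.atTop ≤ K*e := by
  apply le_of_forall_pos_le_add
  intro η hη
  have h1 := h (e + η/K) (by have := div_pos hη hK; linarith)
  have e1 : K*(e+η/K) = K*e + η := by field_simp
  rw [e1] at h1
  refine Filter.limsup_le_of_le ?_ h1
  refine Filter.IsBoundedUnder.isCoboundedUnder_le ⟨0, ?_⟩
  simp

set_option maxHeartbeats 1000000 in
theorem hr_network_synchronization
    (n : ℕ) (a b c d eps s x₀bar γ : ℝ) (I : ℝ)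
    (ha : 0 < a) (hb : 0 < b) (hc : 0 < c) (hd : 0 < d) (heps : 0 < eps)
    (hs : 0 < s) (hx₀ : 0 < x₀bar) (hγ : 0 < γ)
    (hγbig : γ > (1 / ((n + 1 : ℝ) * a)) * (d ^ 2 / 2 + b ^ 2))
    (φ : Fin (n + 1) → ℝ → ℝ)
    (hφcont : ∀ i, Continuous (φ i))
    (hφbdd : ∀ i, ∃ C : ℝ, ∀ t, 0 ≤ t → |φ i t| ≤ C)
    (x y z : Fin (n + 1) → ℝ → ℝ)
    (hx : ∀ i, ∀ t, 0 ≤ t → HasDerivAt (x i)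
        (-a * (x i t) ^ 3 + b * (x i t) ^ 2 + y i t - z i t + I +
          γ * (-(n : ℝ) * x i t + ∑ j ∈ Finset.univ.erase i, x j t) + φ i t) t)
    (hy : ∀ i, ∀ t, 0 ≤ t → HasDerivAt (y i) (c - d * (x i t) ^ 2 - y i t) t)
    (hz : ∀ i, ∀ t, 0 ≤ t →
        HasDerivAt (z i) (eps * (s * (x i t + x₀bar) - z i t)) t) :
    ∃ δ : ℝ → ℝ,
      (∀ ε', 0 ≤ ε' → 0 ≤ δ ε') ∧
      MonotoneOn δ (Set.Ici 0) ∧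
      Filter.Tendsto δ (nhdsWithin 0 (Set.Ioi 0)) (nhds 0) ∧
      ∀ i j : Fin (n + 1), ∀ ε' : ℝ, 0 ≤ ε' →
        Filter.limsup (fun t => |φ i t - φ j t|) Filter.atTop ≤ ε' →
        (Filter.limsup (fun t => |x i t - x j t|) Filter.atTop ≤ δ ε' ∧
         Filter.limsup (fun t => |y i t - y j t|) Filter.atTop ≤ δ ε' ∧
         Filter.limsup (fun t => |z i t - z j t|) Filter.atTop ≤ δ ε') := by
  obtain ⟨κ₂, hκ₂⟩ : ∃ κ₂, κ₂ = γ*(n+1) - a*((d/a)^2/2 + (b/a)^2) := ⟨_, rfl⟩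
  have hκ₂pos : 0 < κ₂ := by
    have hn : (0:ℝ) < n + 1 := by positivity
    have h1 : (1 / ((n + 1 : ℝ) * a)) * (d ^ 2 / 2 + b ^ 2) * (n+1)
      = a*((d/a)^2/2 + (b/a)^2) := by field_simp
    have := mul_lt_mul_of_pos_right hγbig hn
    rw [h1] at this
    linarith
  obtain ⟨μ, hμ⟩ : ∃ μ, μ = min κ₂ (min (1/4) (2*eps)) := ⟨_, rfl⟩
  have hμpos : 0 < μ := by
    rw [hμ]; exact lt_min hκ₂pos (lt_min (by norm_num) (by positivity))
  have m1 : μ ≤ κ₂ := hμ ▸ min_le_left _ _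
  have m2 : μ ≤ 1/4 := hμ ▸ (min_le_right _ _).trans (min_le_left _ _)
  have m3 : μ ≤ 2*eps := hμ ▸ (min_le_right _ _).trans (min_le_right _ _)
  obtain ⟨A, hA⟩ : ∃ A, A = 1/(κ₂*μ) := ⟨_, rfl⟩
  have hApos : 0 < A := by rw [hA]; positivity
  obtain ⟨K, hK⟩ : ∃ K, K = Real.sqrt (2*A*(1 + d^2/a + eps*s)) := ⟨_, rfl⟩
  have hKpos : 0 < K := by rw [hK]; positivity
  have hKsq : K^2 = 2*A*(1 + d^2/a + eps*s) := by
    rw [hK]; exact Real.sq_sqrt (by positivity)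
  refine ⟨fun e => K*e, fun e he => mul_nonneg hKpos.le he, ?_, ?_, ?_⟩
  · intro u _ v _ h
    exact mul_le_mul_of_nonneg_left h hKpos.le
  · have : Filter.Tendsto (fun e : ℝ => K*e) (nhds 0) (nhds (K*0)) :=
      (continuous_const.mul continuous_id).tendsto 0
    rw [mul_zero] at this
    exact this.mono_left nhdsWithin_le_nhds
  intro i j e he hlim
  have main : ∀ e₁, e < e₁ → ∀ᶠ t in Filter.atTop,
      (x i t - x j t)^2/2 + a*((y i t - y j t)/d)^2/2 + 1/(eps*s)*((z i t - z j t)^2/2)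
        ≤ A*e₁^2 := by
    intro e₁ he₁
    have he₁pos : 0 < e₁ := lt_of_le_of_lt he he₁
    have hev : ∀ᶠ t in Filter.atTop, |φ i t - φ j t| < e₁ := by
      refine Filter.eventually_lt_of_limsup_lt (lt_of_le_of_lt hlim he₁) ?_
      obtain ⟨C₁, h₁⟩ := hφbdd i
      obtain ⟨C₂, h₂⟩ := hφbdd j
      refine ⟨C₁ + C₂, ?_⟩
      rw [Filter.eventually_map]
      filter_upwards [Filter.eventually_ge_atTop 0] with t ht
      exact (abs_sub _ _).trans (add_le_add (h₁ t ht) (h₂ t ht))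
    obtain ⟨T, hT⟩ := Filter.eventually_atTop.1 (hev.and (Filter.eventually_ge_atTop 0))
    have hX : ∀ t, T ≤ t → HasDerivAt (fun t => x i t - x j t) _ t :=
      fun t ht => (hx i t (hT t ht).2).sub (hx j t (hT t ht).2)
    have hW : ∀ t, T ≤ t → HasDerivAt (fun t => (y i t - y j t)/d) _ t :=
      fun t ht => ((hy i t (hT t ht).2).sub (hy j t (hT t ht).2)).div_const d
    have hZ : ∀ t, T ≤ t → HasDerivAt (fun t => z i t - z j t) _ t :=
      fun t ht => (hz i t (hT t ht).2).sub (hz j t (hT t ht).2)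
    have hV := fun t (ht : T ≤ t) => ((((hX t ht).pow 2).div_const 2).add
      ((((hW t ht).pow 2).const_mul a).div_const 2)).add
      ((((hZ t ht).pow 2).div_const 2).const_mul (1/(eps*s)))
    have hG := hr_gronwall (fun t => (x i t - x j t)^2/2 + a*((y i t - y j t)/d)^2/2
      + 1/(eps*s)*((z i t - z j t)^2/2)) _ μ (e₁^2/(2*κ₂)) T (A*e₁^2/2) hμpos
      (by positivity) hV ?_
    · filter_upwards [hG] with t ht
      refine ht.trans (le_of_eq ?_)
      rw [hA]; field_simp; ring
    · intro t ht
      have halg := hr_alg a (d/a) (b/a) (γ*(n+1)) κ₂ μ eps s (x i t) (x j t)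
        ((y i t - y j t)/d) (z i t - z j t) (φ i t - φ j t) ha (by positivity) (by positivity)
        heps hs hκ₂pos (by rw [hκ₂]; ring) m1 m2 m3
      have hf : (φ i t - φ j t)^2/(2*κ₂) ≤ e₁^2/(2*κ₂) := by
        have : (φ i t - φ j t)^2 ≤ e₁^2 :=
          sq_le_sq.2 ((hT t ht).1.le.trans (le_abs_self _))
        gcongr
      refine le_trans (le_of_eq ?_) (halg.trans (add_le_add le_rfl hf))
      have s1 : ∀ k, ∑ l ∈ Finset.univ.erase k, x l t = ∑ l, x l t - x k t := by
        intro k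
        rw [← Finset.add_sum_erase Finset.univ (fun l => x l t) (Finset.mem_univ k)]
        ring
      rw [s1 i, s1 j]
      generalize ∑ l, x l t = S
      generalize 1/(eps*s) = q
      have hYd : y i t = y j t + d*((y i t - y j t)/d) := by field_simp; ring
      have hYd2 : (c - d * x i t ^ 2 - y i t - (c - d * x j t ^ 2 - y j t)) / d
        = -(x i t^2 - x j t^2) - (y i t - y j t)/d := by field_simp; ring
      have hb' : a*(b/a) = b := by field_simp
      have hd' : a*(d/a) = d := by field_simp
      rw [hb', hd', hYd2]
      generalize (y i t - y j t)/d = W at *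
      rw [hYd]
      norm_num
      ring
  have fin : ∀ (f : ℝ → ℝ) (C : ℝ), (0 ≤ C) → 2*A*C ≤ K^2 → (∀ t, f t^2 ≤ 2*C*(
      (x i t - x j t)^2/2 + a*((y i t - y j t)/d)^2/2 + 1/(eps*s)*((z i t - z j t)^2/2))) →
      Filter.limsup (fun t => |f t|) Filter.atTop ≤ K*e := by
    intro f C hC hCK hf
    apply hr_limsup f K e hKpos
    intro e₁ he₁
    have he₁pos : 0 < e₁ := lt_of_le_of_lt he he₁
    filter_upwards [main e₁ he₁] with t ht
    apply abs_le_of_sq_le_sq _ (by positivity)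
    have h1 := mul_le_mul_of_nonneg_left ht (by positivity : 0 ≤ 2*C)
    have h2 := mul_le_mul_of_nonneg_right hCK (sq_nonneg e₁)
    have h3 := hf t
    calc f t^2 ≤ _ := h3
      _ ≤ 2*C*(A*e₁^2) := h1
      _ = 2*A*C*e₁^2 := by ring
      _ ≤ K^2*e₁^2 := h2
      _ = (K*e₁)^2 := by ring
  have p1 : 0 < d^2/a := by positivity
  have p2 : 0 < eps*s := by positivity
  refine ⟨fin _ 1 (by norm_num) ?_ ?_, fin _ (d^2/a) p1.le ?_ ?_, fin _ (eps*s) p2.le ?_ ?_⟩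
  · rw [hKsq]; exact mul_le_mul_of_nonneg_left (by linarith) (by positivity)
  · intro t
    have h1 : 0 ≤ a*((y i t - y j t)/d)^2/2 := by positivity
    have h2 : 0 ≤ 1/(eps*s)*((z i t - z j t)^2/2) := by positivity
    linarith
  · rw [hKsq]; exact mul_le_mul_of_nonneg_left (by linarith) (by positivity)
  · intro t
    have h1 : 0 ≤ d^2/a*((x i t - x j t)^2/2) := by positivity
    have h2 : 0 ≤ d^2/a*(1/(eps*s)*((z i t - z j t)^2/2)) := by positivity
    have h3 : 2*(d^2/a)*(a*((y i t - y j t)/d)^2/2) = (y i t - y j t)^2 := by field_simp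
    linarith
  · rw [hKsq]; exact mul_le_mul_of_nonneg_left (by linarith) (by positivity)
  · intro t
    have h1 : 0 ≤ eps*s*((x i t - x j t)^2/2) := by positivity
    have h2 : 0 ≤ eps*s*(a*((y i t - y j t)/d)^2/2) := by positivity
    have h3 : 2*(eps*s)*(1/(eps*s)*((z i t - z j t)^2/2)) = (z i t - z j t)^2 := by field_simp
    linarith
end

section
/- Semi-passivity of the Hindmarsh-Rose oscillator. For all constants a, b, c, d, eps, s, x_0bar > 0 and I in R, there exist constants c_1, c_2, c_3 > 0, kappa > 0 and M in R such that for all x, y, z in R: c_1*x*(-a*x^3 + b*x^2 + y - z + I) + c_2*y*(c - d*x^2 - y) + c_3*z*eps*(s*(x + x_0bar) - z) <= M - kappa*(x^4 + y^2 + z^2). Consequently, with storage function V(x,y,z) = (c_1*x^2 + c_2*y^2 + c_3*z^2)/(2*c_1), along any solution of x' = -a*x^3 + b*x^2 + y - z + I + u, y' = c - d*x^2 - y, z' = eps*(s*(x + x_0bar) - z) one has dV/dt <= x*u - H(x,y,z), where H(x,y,z) := (kappa*(x^4 + y^2 + z^2) - M)/c_1 is radially unbounded and nonnegative outside a ball in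 R^3. -/
theorem hr_core (a b c d s x0 I e : ℝ) (ha : 0 < a) (hs : 0 < s) (he : 0 < e)
    (hed : e * d ^ 2 = a) (x y z : ℝ) :
    x * (-a * x ^ 3 + b * x ^ 2 + y) + I * x + e * y * (c - d * x ^ 2 - y) + x0 * z - z ^ 2 / s ≤
      (I ^ 2 / 4 + 2 * e * c ^ 2 + s * x0 ^ 2 / 2 + 2 * (2 * b ^ 2 / a + 2 / e + 1) ^ 2 / a)
      - (a / 4 * x ^ 4 + e / 4 * y ^ 2 + 1 / (2 * s) * z ^ 2) := by
  have h1 : 0 ≤ e / 2 * (d * x ^ 2 + y) ^ 2 := by positivity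
  have h1' : e / 2 * (d * x ^ 2 + y) ^ 2 = a / 2 * x ^ 4 + e * d * x ^ 2 * y + e / 2 * y ^ 2 := by
    rw [← hed]; ring
  have h2 : x * y ≤ e / 8 * y ^ 2 + 2 / e * x ^ 2 := by
    have h : 0 ≤ (e * y - 4 * x) ^ 2 / (8 * e) := by positivity
    have h' : (e * y - 4 * x) ^ 2 / (8 * e) = e / 8 * y ^ 2 + 2 / e * x ^ 2 - x * y := by
      field_simp; ring
    linarith
  have h3 : 0 ≤ e / 8 * (y - 4 * c) ^ 2 := by positivity
  have h4 : x0 * z ≤ 1 / (2 * s) * z ^ 2 + s * x0 ^ 2 / 2 := by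
    have h : 0 ≤ (z - s * x0) ^ 2 / (2 * s) := by positivity
    have h' : (z - s * x0) ^ 2 / (2 * s) = 1 / (2 * s) * z ^ 2 + s * x0 ^ 2 / 2 - x0 * z := by
      field_simp; ring
    linarith
  have h4' : z ^ 2 / s = 1 / (2 * s) * z ^ 2 + 1 / (2 * s) * z ^ 2 := by field_simp; ring
  have h5 : b * x ^ 3 ≤ a / 8 * x ^ 4 + 2 * b ^ 2 / a * x ^ 2 := by
    have h : 0 ≤ (a * x ^ 2 - 4 * b * x) ^ 2 / (8 * a) := by positivity
    have h' : (a * x ^ 2 - 4 * b * x) ^ 2 / (8 * a)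
        = a / 8 * x ^ 4 + 2 * b ^ 2 / a * x ^ 2 - b * x ^ 3 := by
      field_simp; ring
    linarith
  have h6 : 0 ≤ (x - I / 2) ^ 2 := by positivity
  generalize 2 / e = g at *
  generalize 2 * b ^ 2 / a = k at *
  have h7 : (k + g + 1) * x ^ 2 ≤ a / 8 * x ^ 4 + 2 * (k + g + 1) ^ 2 / a := by
    generalize k + g + 1 = K
    have h : 0 ≤ (a * x ^ 2 - 4 * K) ^ 2 / (8 * a) := by positivity
    have h' : (a * x ^ 2 - 4 * K) ^ 2 / (8 * a)
        = a / 8 * x ^ 4 + 2 * K ^ 2 / a - K * x ^ 2 := by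
      field_simp; ring
    linarith
  linarith

theorem hr_bound (κ M : ℝ) (hκ : 0 < κ) (p : ℝ × ℝ × ℝ) :
    κ * (‖p‖ ^ 2 - 1) - M ≤ (κ * (p.1 ^ 4 + p.2.1 ^ 2 + p.2.2 ^ 2) - M) / 1 := by
  obtain ⟨x, y, z⟩ := p
  have h : ‖(x, y, z)‖ ^ 2 ≤ x ^ 2 + y ^ 2 + z ^ 2 := by
    simp only [Prod.norm_mk, Real.norm_eq_abs]
    have hx := sq_nonneg x
    have hy := sq_nonneg y
    have hz := sq_nonneg z
    rcases max_choice |x| (max |y| |z|) with h | h <;> rw [h]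
    · rw [sq_abs]; linarith
    · rcases max_choice |y| |z| with h | h <;> rw [h, sq_abs] <;> linarith
  have h2 : x ^ 2 - 1 ≤ x ^ 4 := by nlinarith [sq_nonneg (x ^ 2 - 1), sq_nonneg x]
  rw [div_one]
  have := mul_le_mul_of_nonneg_left
    (show ‖(x, y, z)‖ ^ 2 - 1 ≤ x ^ 4 + y ^ 2 + z ^ 2 by linarith) hκ.le
  simpa using this

theorem hr_tendsto (κ M : ℝ) (hκ : 0 < κ) :
    Filter.Tendsto (fun r : ℝ => κ * (r ^ 2 - 1) - M) Filter.atTop Filter.atTop := by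
  have h1 : Filter.Tendsto (fun r : ℝ => r ^ 2) Filter.atTop Filter.atTop :=
    Filter.tendsto_pow_atTop two_ne_zero
  have h2 := Filter.tendsto_atTop_add_const_right Filter.atTop (-κ - M) (h1.const_mul_atTop hκ)
  refine h2.congr fun r => ?_
  ring

/-!
Semi-passivity of the Hindmarsh-Rose oscillator.

There exist `c₁, c₂, c₃, κ > 0` and `M ∈ ℝ` such that the quadratic storage
candidate satisfies the dissipation inequality
`c₁ x ẋ|_{u=0} + c₂ y ẏ + c₃ z ż ≤ M - κ (x⁴ + y² + z²)`;
consequently `V(x,y,z) = (c₁x² + c₂y² + c₃z²)/(2c₁)` satisfies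
`dV/dt ≤ x u - H(x,y,z)` along solutions, where
`H(x,y,z) = (κ(x⁴ + y² + z²) - M)/c₁` is radially unbounded and nonnegative
outside a ball in `ℝ³`.
-/
theorem hr_semipassivity
    (a b c d eps s x₀bar : ℝ) (I : ℝ)
    (ha : 0 < a) (hb : 0 < b) (hc : 0 < c) (hd : 0 < d)
    (heps : 0 < eps) (hs : 0 < s) (hx₀ : 0 < x₀bar) :
    ∃ c₁ c₂ c₃ κ : ℝ, ∃ M : ℝ, 0 < c₁ ∧ 0 < c₂ ∧ 0 < c₃ ∧ 0 < κ ∧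
      -- core dissipation inequality
      (∀ x y z : ℝ,
        c₁ * x * (-a * x ^ 3 + b * x ^ 2 + y - z + I) +
            c₂ * y * (c - d * x ^ 2 - y) +
            c₃ * z * (eps * (s * (x + x₀bar) - z)) ≤
          M - κ * (x ^ 4 + y ^ 2 + z ^ 2)) ∧
      -- consequence: dV/dt ≤ x·u - H along solutions
      (∀ u X Y Z : ℝ → ℝ,
        (∀ t : ℝ, HasDerivAt X
            (-a * (X t) ^ 3 + b * (X t) ^ 2 + Y t - Z t + I + u t) t) →
        (∀ t : ℝ, HasDerivAt Y (c - d * (X t) ^ 2 - Y t) t) →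
        (∀ t : ℝ, HasDerivAt Z (eps * (s * (X t + x₀bar) - Z t)) t) →
        ∀ t : ℝ, ∃ V' : ℝ,
          HasDerivAt
            (fun τ => (c₁ * (X τ) ^ 2 + c₂ * (Y τ) ^ 2 + c₃ * (Z τ) ^ 2) / (2 * c₁))
            V' t ∧
          V' ≤ X t * u t -
            (κ * ((X t) ^ 4 + (Y t) ^ 2 + (Z t) ^ 2) - M) / c₁) ∧
      -- H is radially unbounded
      Filter.Tendsto
        (fun p : ℝ × ℝ × ℝ => (κ * (p.1 ^ 4 + p.2.1 ^ 2 + p.2.2 ^ 2) - M) / c₁)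
        (Filter.cocompact (ℝ × ℝ × ℝ)) Filter.atTop ∧
      -- H is nonnegative outside a ball
      (∃ R : ℝ, ∀ p : ℝ × ℝ × ℝ, R ≤ ‖p‖ →
        0 ≤ (κ * (p.1 ^ 4 + p.2.1 ^ 2 + p.2.2 ^ 2) - M) / c₁) := by
  obtain ⟨e, he, hed⟩ : ∃ e : ℝ, 0 < e ∧ e * d ^ 2 = a :=
    ⟨a / d ^ 2, by positivity, by field_simp⟩
  obtain ⟨κ, hκ, k1, k2, k3⟩ : ∃ κ : ℝ, 0 < κ ∧ κ ≤ a / 4 ∧ κ ≤ e / 4 ∧ κ ≤ 1 / (2 * s) :=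
    ⟨min (a / 4) (min (e / 4) (1 / (2 * s))), by positivity, min_le_left _ _,
      (min_le_right _ _).trans (min_le_left _ _), (min_le_right _ _).trans (min_le_right _ _)⟩
  obtain ⟨M, hM⟩ : ∃ M, ∀ x y z : ℝ,
        1 * x * (-a * x ^ 3 + b * x ^ 2 + y - z + I) +
            e * y * (c - d * x ^ 2 - y) +
            (1 / (eps * s)) * z * (eps * (s * (x + x₀bar) - z)) ≤
          M - κ * (x ^ 4 + y ^ 2 + z ^ 2) := by
    refine ⟨I ^ 2 / 4 + 2 * e * c ^ 2 + s * x₀bar ^ 2 / 2 +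
      2 * (2 * b ^ 2 / a + 2 / e + 1) ^ 2 / a, fun x y z => ?_⟩
    · have h := hr_core a b c d s x₀bar I e ha hs he hed x y z
      have hz : (1 / (eps * s)) * z * (eps * (s * (x + x₀bar) - z))
          = x * z + x₀bar * z - z ^ 2 / s := by field_simp
      have m1 := mul_le_mul_of_nonneg_right k1 (show 0 ≤ x ^ 4 by positivity)
      have m2 := mul_le_mul_of_nonneg_right k2 (sq_nonneg y)
      have m3 := mul_le_mul_of_nonneg_right k3 (sq_nonneg z)
      rw [hz]
      refine le_trans (le_of_eq ?_) (h.trans (sub_le_sub_left ?_ _))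
      · ring
      · linarith
  refine ⟨1, e, 1 / (eps * s), κ, M, one_pos, he, by positivity, hκ, hM, ?_, ?_, ?_⟩
  · intro u X Y Z hX hY hZ t
    refine ⟨_, (((((hX t).pow 2).const_mul 1).add (((hY t).pow 2).const_mul e)).add
      (((hZ t).pow 2).const_mul (1 / (eps * s)))).div_const (2 * 1), ?_⟩
    have h := hM (X t) (Y t) (Z t)
    generalize 1 / (eps * s) = q at *
    norm_num
    linarith
  · exact Filter.tendsto_atTop_mono (hr_bound κ M hκ)
      ((hr_tendsto κ M hκ).comp (tendsto_norm_cocompact_atTop (E := ℝ × ℝ × ℝ)))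
  · obtain ⟨R, hR⟩ := Filter.eventually_atTop.1
      ((hr_tendsto κ M hκ).eventually (Filter.eventually_ge_atTop 0))
    exact ⟨R, fun p hp => (hR _ hp).trans (hr_bound κ M hκ p)⟩
end

section
/- Pairwise Lyapunov drift inequality for coupled Hindmarsh-Rose oscillators. Let a, b, d, eps, s > 0, n in N, r in (0,1), eps_2 > 0, and set gamma := (1/((n+1)*a))*(d^2/(2*r^2) + b^2) + eps_2. Let C_x > 0, C_y := C_x*a*r/d^2, C_z := C_x/(s*eps), and alpha := 2*min(eps_2, eps, 1-r). Then for all real x_1, x_2, y_1, y_2, z_1, z_2: C_x*(x_1 - x_2)*( -a*(x_1^3 - x_2^3) + b*(x_1^2 - x_2^2) + (y_1 - y_2) - (z_1 - z_2) - gamma*(n+1)*(x_1 - x_2) ) + C_y*(y_1 - y_2)*( -d*(x_1^2 - x_2^2) - (y_1 - y_2) ) + C_z*(z_1 - z_2)*eps*( s*(x_1 - x_2) - (z_1 - z_2) ) <= -alpha * (1/2)*( C_x*(x_1 - x_2)^2 + C_y*(y_1 - y_2)^2 + C_z*(z_1 - z_2)^2 ). -/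
/-!
Pairwise Lyapunov drift inequality for two coupled Hindmarsh-Rose oscillators
in a network of `n+1` oscillators with symmetric linear coupling of strength
`γ = (1/((n+1)a))(d²/(2r²) + b²) + ε₂`, with `C_y = C_x a r / d²`,
`C_z = C_x/(s·eps)` and `α = 2 min(ε₂, eps, 1-r)`.
-/
theorem hr_pairwise_drift
    (a b d eps s : ℝ) (n : ℕ) (r eps₂ : ℝ)
    (ha : 0 < a) (hb : 0 < b) (hd : 0 < d) (heps : 0 < eps) (hs : 0 < s)
    (hr : r ∈ Set.Ioo (0 : ℝ) 1) (heps₂ : 0 < eps₂)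
    (γ Cx Cy Cz α : ℝ) (hCx : 0 < Cx)
    (hγ : γ = (1 / ((n + 1 : ℝ) * a)) * (d ^ 2 / (2 * r ^ 2) + b ^ 2) + eps₂)
    (hCy : Cy = Cx * a * r / d ^ 2) (hCz : Cz = Cx / (s * eps))
    (hα : α = 2 * min eps₂ (min eps (1 - r))) :
    ∀ x₁ x₂ y₁ y₂ z₁ z₂ : ℝ,
      Cx * (x₁ - x₂) *
          (-a * (x₁ ^ 3 - x₂ ^ 3) + b * (x₁ ^ 2 - x₂ ^ 2) + (y₁ - y₂) -
            (z₁ - z₂) - γ * (n + 1 : ℝ) * (x₁ - x₂)) +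
        Cy * (y₁ - y₂) * (-d * (x₁ ^ 2 - x₂ ^ 2) - (y₁ - y₂)) +
        Cz * (z₁ - z₂) * (eps * (s * (x₁ - x₂) - (z₁ - z₂))) ≤
      -α * ((1 : ℝ) / 2) *
        (Cx * (x₁ - x₂) ^ 2 + Cy * (y₁ - y₂) ^ 2 + Cz * (z₁ - z₂) ^ 2) := by
  intro x₁ x₂ y₁ y₂ z₁ z₂
  obtain ⟨hr0, hr1⟩ := hr
  have hN1 : (1 : ℝ) ≤ (n : ℝ) + 1 := by
    have : (0 : ℝ) ≤ n := Nat.cast_nonneg n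
    linarith
  generalize hm : min eps₂ (min eps (1 - r)) = m at hα
  have m1 : m ≤ eps₂ := hm ▸ min_le_left _ _
  have m2 : m ≤ eps := hm ▸ (min_le_right _ _).trans (min_le_left _ _)
  have m3 : m ≤ 1 - r := hm ▸ (min_le_right _ _).trans (min_le_right _ _)
  generalize (n : ℝ) + 1 = N at *
  have hN : 0 < N := by linarith
  have m1' : 0 ≤ N * eps₂ - m := by nlinarith
  have hCy0 : 0 < Cy := by rw [hCy]; positivity
  have hCz0 : 0 < Cz := by rw [hCz]; positivity
  have p1 : 0 ≤ Cx * (x₁ - x₂) ^ 2 * (N * eps₂ - m) := by positivity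
  have p2 : 0 ≤ Cy * (y₁ - y₂) ^ 2 * (1 - r - m) :=
    mul_nonneg (by positivity) (by linarith)
  have p3 : 0 ≤ Cz * (z₁ - z₂) ^ 2 * (eps - m) :=
    mul_nonneg (by positivity) (by linarith)
  have p4 : 0 ≤ Cx * (a * (x₁ - x₂) ^ 4 / 4
      + (x₁ - x₂) ^ 2 * ((d / r + a * (x₁ + x₂)) ^ 2 + (a * (x₁ + x₂) - 2 * b) ^ 2) / (4 * a)
      + a * ((y₁ - y₂) * r / d - (x₁ - x₂) * (d / r - a * (x₁ + x₂)) / (2 * a)) ^ 2) := by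
    positivity
  rw [← sub_nonneg]
  refine (add_nonneg (add_nonneg (add_nonneg p1 p2) p3) p4).trans_eq ?_
  subst hα hγ hCy hCz
  field_simp
  ring
end

section
/- Cascade estimate for the temporal integration error. Let tau, gamma_1, k, D_3, D_4, M_1 > 0 with beta := gamma_1*k*D_3 != 1/tau. Let alpha, w : [t_0, infinity) -> R be continuous with k*D_3 <= alpha(t) <= k*D_4 and |w(t)| <= M_1 for all t >= t_0, let delta_1 : [t_0, infinity) -> R be continuous with |delta_1(t)| <= exp(-beta*(t - t_0))*|delta_1(t_0)| + M_1/(k*D_3) for all t >= t_0, and let e : [t_0, infinity) -> R be differentiable with e'(t) = -(1/tau)*e(t) + delta_1(t)*alpha(t) + w(t). Then for all t >= t_0: |e(t)| <= exp(-(t - t_0)/tau)*|e(t_0)| + M_1*tau*(1 + D_4/D_3) + eps_1(t), where eps_1(t) := k*D_4*|delta_1(t_0)| * ( exp(-beta*(t - t_0)) - exp(-(t - t_0)/tau) ) / (1/tau - beta); in particular eps_1(t) >= 0 and eps_1(t) -> 0 as t -> infinity, so limsup_{t->infinity} |e(t)| <= M_1*tau*(1 + D_4/D_3). -/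
theorem cascade_aux (c t₀ : ℝ) (f f' : ℝ → ℝ)
    (hf : ∀ t, t₀ ≤ t → HasDerivAt f (f' t) t)
    (hf' : ∀ t, t₀ ≤ t → 0 ≤ f' t + c * f t) (h0 : 0 ≤ f t₀) :
    ∀ t, t₀ ≤ t → 0 ≤ f t := by
  have hd : ∀ t, t₀ ≤ t → HasDerivAt (fun t => Real.exp (c * t) * f t)
      (Real.exp (c * t) * (f' t + c * f t)) t := by
    intro t ht
    have h1 : HasDerivAt (fun t : ℝ => c * t) c t := by
      simpa using (hasDerivAt_id t).const_mul c
    have := h1.exp.mul (hf t ht)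
    refine this.congr_deriv ?_
    ring
  have hm : MonotoneOn (fun t => Real.exp (c * t) * f t) (Set.Ici t₀) := by
    apply monotoneOn_of_deriv_nonneg (convex_Ici t₀)
    · intro t ht
      exact (hd t ht).continuousAt.continuousWithinAt
    · intro t ht
      exact (hd t (interior_subset ht)).differentiableAt.differentiableWithinAt
    · intro t ht
      have ht' : t₀ ≤ t := interior_subset ht
      rw [(hd t ht').deriv]
      exact mul_nonneg (Real.exp_pos _).le (hf' t ht')
  intro t ht
  have h2 : Real.exp (c * t₀) * f t₀ ≤ Real.exp (c * t) * f t :=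
    hm (Set.mem_Ici.2 le_rfl) (Set.mem_Ici.2 ht) ht
  have h3 : 0 ≤ Real.exp (c * t) * f t := (mul_nonneg (Real.exp_pos _).le h0).trans h2
  exact nonneg_of_mul_nonneg_right h3 (Real.exp_pos _)

theorem cascade_estimate
    (τ γ₁ k D₃ D₄ M₁ t₀ : ℝ)
    (hτ : 0 < τ) (hγ₁ : 0 < γ₁) (hk : 0 < k) (hD₃ : 0 < D₃) (hD₄ : 0 < D₄)
    (hM₁ : 0 < M₁)
    (β : ℝ) (hβ : β = γ₁ * k * D₃) (hβne : β ≠ 1 / τ)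
    (α w : ℝ → ℝ) (hαcont : Continuous α) (hwcont : Continuous w)
    (hα : ∀ t, t₀ ≤ t → k * D₃ ≤ α t ∧ α t ≤ k * D₄)
    (hw : ∀ t, t₀ ≤ t → |w t| ≤ M₁)
    (δ₁ : ℝ → ℝ) (hδ₁cont : Continuous δ₁)
    (hδ₁ : ∀ t, t₀ ≤ t →
        |δ₁ t| ≤ Real.exp (-β * (t - t₀)) * |δ₁ t₀| + M₁ / (k * D₃))
    (e : ℝ → ℝ)
    (he : ∀ t, t₀ ≤ t → HasDerivAt e (-(1 / τ) * e t + δ₁ t * α t + w t) t)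
    (ε₁ : ℝ → ℝ)
    (hε₁ : ∀ t, ε₁ t = k * D₄ * |δ₁ t₀| *
        (Real.exp (-β * (t - t₀)) - Real.exp (-(t - t₀) / τ)) / (1 / τ - β)) :
    (∀ t, t₀ ≤ t → 0 ≤ ε₁ t ∧
        |e t| ≤ Real.exp (-(t - t₀) / τ) * |e t₀| +
          M₁ * τ * (1 + D₄ / D₃) + ε₁ t) ∧
    Filter.Tendsto ε₁ Filter.atTop (nhds 0) ∧
    Filter.limsup (fun t => |e t|) Filter.atTop ≤ M₁ * τ * (1 + D₄ / D₃) := by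
  have hβpos : 0 < β := by rw [hβ]; positivity
  have hne : 1 / τ - β ≠ 0 := sub_ne_zero.2 hβne.symm
  obtain ⟨a, ha⟩ : ∃ a, a = 1 / τ := ⟨_, rfl⟩
  have hapos : 0 < a := by rw [ha]; positivity
  have hdiv : ∀ t, -(t - t₀) / τ = -a * (t - t₀) := by
    intro t; rw [ha]; ring
  obtain ⟨C, hC⟩ : ∃ C, C = M₁ * τ * (1 + D₄ / D₃) := ⟨_, rfl⟩
  have haC : a * C = M₁ * (1 + D₄ / D₃) := by
    rw [ha, hC]; field_simp
  have hCpos : 0 < C := by rw [hC]; positivity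
  simp only [hdiv, ← ha, ← hC] at *
  have hexp : ∀ b t : ℝ, HasDerivAt (fun t => Real.exp (-b * (t - t₀)))
      (-b * Real.exp (-b * (t - t₀))) t := by
    intro b t
    have h1 : HasDerivAt (fun t : ℝ => -b * (t - t₀)) (-b) t := by
      simpa using ((hasDerivAt_id t).sub_const t₀).const_mul (-b)
    refine h1.exp.congr_deriv ?_
    ring
  have htend : ∀ b : ℝ, 0 < b →
      Filter.Tendsto (fun t => Real.exp (-b * (t - t₀))) Filter.atTop (nhds 0) := by
    intro b hb
    apply Real.tendsto_exp_atBot.comp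
    apply Filter.Tendsto.const_mul_atTop_of_neg (by linarith)
    exact Filter.tendsto_atTop_add_const_right _ _ Filter.tendsto_id
  have hεfun : ε₁ = fun t => k * D₄ * |δ₁ t₀| *
        (Real.exp (-β * (t - t₀)) - Real.exp (-a * (t - t₀))) / (a - β) := funext hε₁
  have hεd : ∀ t, HasDerivAt ε₁
      (-a * ε₁ t + k * D₄ * |δ₁ t₀| * Real.exp (-β * (t - t₀))) t := by
    intro t
    have h := (((hexp β t).sub (hexp a t)).const_mul (k * D₄ * |δ₁ t₀|)).div_const (a - β)
    rw [hε₁ t, hεfun]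
    refine h.congr_deriv ?_
    field_simp
    ring
  have hεnn : ∀ t, t₀ ≤ t → 0 ≤ ε₁ t := by
    refine cascade_aux a t₀ _ _ (fun t _ => hεd t) (fun t _ => ?_) ?_
    · have : 0 ≤ k * D₄ * |δ₁ t₀| * Real.exp (-β * (t - t₀)) := by positivity
      linarith
    · rw [hε₁]; simp
  have hεt : Filter.Tendsto ε₁ Filter.atTop (nhds 0) := by
    rw [hεfun]
    simpa using (((htend β hβpos).sub (htend a hapos)).const_mul
      (k * D₄ * |δ₁ t₀|)).div_const (a - β)
  have hforce : ∀ t, t₀ ≤ t → |δ₁ t * α t + w t| ≤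
      k * D₄ * |δ₁ t₀| * Real.exp (-β * (t - t₀)) + a * C := by
    intro t ht
    obtain ⟨h1, h2⟩ := hα t ht
    have h0 : 0 ≤ α t := le_trans (by positivity) h1
    have h3 : |δ₁ t| * α t ≤
        (Real.exp (-β * (t - t₀)) * |δ₁ t₀| + M₁ / (k * D₃)) * (k * D₄) :=
      mul_le_mul (hδ₁ t ht) h2 h0 (by positivity)
    have h4 : |δ₁ t * α t + w t| ≤ |δ₁ t| * α t + |w t| := by
      refine (abs_add_le _ _).trans ?_
      rw [abs_mul, abs_of_nonneg h0]
    have h5 : M₁ / (k * D₃) * (k * D₄) = M₁ * (D₄ / D₃) := by field_simp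
    have h6 := hw t ht
    rw [haC]
    nlinarith
  have hmain : ∀ t, t₀ ≤ t →
      |e t| ≤ Real.exp (-a * (t - t₀)) * |e t₀| + C + ε₁ t := by
    have hB : ∀ t, HasDerivAt (fun t => Real.exp (-a * (t - t₀)) * |e t₀| + C + ε₁ t)
        (-a * Real.exp (-a * (t - t₀)) * |e t₀| +
          (-a * ε₁ t + k * D₄ * |δ₁ t₀| * Real.exp (-β * (t - t₀)))) t := by
      intro t
      exact (((hexp a t).mul_const _).add_const C).add (hεd t)
    have hε0 : ε₁ t₀ = 0 := by rw [hε₁]; simp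
    have hup := cascade_aux a t₀ _ _ (fun t ht => (hB t).sub (he t ht))
      (fun t ht => by
        have := (abs_le.1 (hforce t ht)).2
        simp only [Pi.sub_apply]
        nlinarith)
      (by
        have := le_abs_self (e t₀)
        simp [hε0]
        linarith)
    have hlo := cascade_aux a t₀ _ _ (fun t ht => (hB t).add (he t ht))
      (fun t ht => by
        have := (abs_le.1 (hforce t ht)).1
        simp only [Pi.add_apply]
        nlinarith)
      (by
        have := neg_abs_le (e t₀)
        simp [hε0]
        linarith)
    intro t ht
    have h1 := hup t ht
    have h2 := hlo t ht
    simp only [Pi.sub_apply, Pi.add_apply] at h1 h2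
    exact abs_le.2 ⟨by linarith, by linarith⟩
  refine ⟨fun t ht => ⟨hεnn t ht, hmain t ht⟩, hεt, ?_⟩
  have hBt : Filter.Tendsto (fun t => Real.exp (-a * (t - t₀)) * |e t₀| + C + ε₁ t)
      Filter.atTop (nhds C) := by
    simpa using (((htend a hapos).mul_const |e t₀|).add_const C).add hεt
  rw [← hBt.limsup_eq]
  refine Filter.limsup_le_limsup ?_ ?_ hBt.isBoundedUnder_le
  · filter_upwards [Filter.eventually_ge_atTop t₀] with t ht using hmain t ht
  · exact Filter.IsBoundedUnder.isCoboundedUnder_le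
      (Filter.isBoundedUnder_of ⟨0, fun t => abs_nonneg _⟩)
end

section
/- Optimality of sampled representations (Appendix 1). Let N > 1 be real, lambda_1, lambda_2 > 0, and H_s >= 0, and suppose lambda_1*H_s^2 < lambda_2 < lambda_1*N*(ln N + H_s)^2. Define the total loss Q(k) := lambda_1*N/k + lambda_2/( ln(N/k) + H_s ) for k in [1, N). Then Q attains a global minimum on [1, N) at some interior point: there exists k* in (1, N) such that Q(k*) <= Q(k) for all k in [1, N) and Q(k*) < Q(1). In other words, the optimal sampling scale is neither the elementary partition k = 1 nor the trivial partition k -> N. -/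
/-!
Optimality of sampled representations (Appendix 1): the total loss
`Q(k) = λ₁ N / k + λ₂ / (ln(N/k) + H_s)` (cost plus ambiguity) attains its
global minimum on `[1, N)` at an interior point `k* ∈ (1, N)`.
-/
theorem optimal_sampling
    (N lam₁ lam₂ Hs : ℝ) (hN : 1 < N) (hlam₁ : 0 < lam₁) (hlam₂ : 0 < lam₂)
    (hHs : 0 ≤ Hs)
    (hlow : lam₁ * Hs ^ 2 < lam₂)
    (hhigh : lam₂ < lam₁ * N * (Real.log N + Hs) ^ 2)
    (Q : ℝ → ℝ)
    (hQ : ∀ k, Q k = lam₁ * N / k + lam₂ / (Real.log (N / k) + Hs)) :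
    ∃ kstar ∈ Set.Ioo (1 : ℝ) N,
      (∀ k ∈ Set.Ico (1 : ℝ) N, Q kstar ≤ Q k) ∧ Q kstar < Q 1 := by
  have hN0 : 0 < N := by linarith
  have hL : 0 < Real.log N := Real.log_pos hN
  obtain ⟨a, ⟨ha0, haL⟩, ha⟩ : ∃ a ∈ Set.Ioo (0 : ℝ) (Real.log N),
      lam₁ * Real.exp a * (a + Hs) ^ 2 = lam₂ := by
    have hc : ContinuousOn (fun u : ℝ => lam₁ * Real.exp u * (u + Hs) ^ 2)
        (Set.Icc 0 (Real.log N)) := by fun_prop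
    apply intermediate_value_Ioo hL.le hc
    refine ⟨?_, ?_⟩
    · simpa using hlow
    · simpa [Real.exp_log hN0] using hhigh
  have key : ∀ u : ℝ, 0 < u → u ≠ a →
      lam₁ * Real.exp a + lam₂ / (a + Hs) < lam₁ * Real.exp u + lam₂ / (u + Hs) := by
    intro u hu hua
    have h1 : Real.exp a * (1 + (u - a)) < Real.exp u := by
      have h := Real.add_one_lt_exp (sub_ne_zero.mpr hua)
      have h2 : Real.exp u = Real.exp a * Real.exp (u - a) := by
        rw [← Real.exp_add]; congr 1; ring
      rw [h2]
      exact mul_lt_mul_of_pos_left (by linarith) (Real.exp_pos a)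
    have hA : 0 < a + Hs := by linarith
    have hU : 0 < u + Hs := by linarith
    have h3 : lam₂ / (a + Hs) = lam₁ * Real.exp a * (a + Hs) := by
      rw [← ha]; field_simp
    have h4 : lam₁ * Real.exp a * (2 * (a + Hs) - (u + Hs)) ≤ lam₂ / (u + Hs) := by
      rw [le_div_iff₀ hU, ← ha, mul_assoc]
      apply mul_le_mul_of_nonneg_left _ (by positivity)
      nlinarith [sq_nonneg (a - u)]
    have h5 := mul_lt_mul_of_pos_left h1 hlam₁
    rw [h3]
    nlinarith
  have hQ' : ∀ k, 0 < k → Q k = lam₁ * Real.exp (Real.log (N / k))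
      + lam₂ / (Real.log (N / k) + Hs) := by
    intro k hk
    rw [hQ, Real.exp_log (div_pos hN0 hk), mul_div_assoc]
  have hk0 : 0 < N / Real.exp a := by positivity
  have hka : Real.log (N / (N / Real.exp a)) = a := by
    rw [div_div_cancel₀ hN0.ne', Real.log_exp]
  refine ⟨N / Real.exp a, ⟨?_, ?_⟩, ?_, ?_⟩
  · rw [lt_div_iff₀ (Real.exp_pos a), one_mul]
    exact (Real.lt_log_iff_exp_lt hN0).mp haL
  · exact div_lt_self hN0 (Real.one_lt_exp_iff.mpr ha0)
  · rintro k ⟨hk1, hkN⟩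
    have hk : 0 < k := by linarith
    rw [hQ' _ hk0, hQ' k hk, hka]
    by_cases h : Real.log (N / k) = a
    · rw [h]
    · exact (key _ (Real.log_pos ((one_lt_div hk).mpr hkN)) h).le
  · rw [hQ' _ hk0, hQ' 1 one_pos, hka, div_one]
    exact key _ hL haL.ne'
end
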